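/- arXiv:2105.10343 — 5 statements merged into one kernel-verified Lean document; each statement's English description precedes it below -/
import Mathlib

section
/- Let c ≠ 0 and let (p̃2, s2) be the maximal solution of the reduced system with constant control a1 = -c²/2 (i.e. p̃2' = (1/2)(p̃2² - c²)·e^{2·s2} + c²/2, s2' = (p̃2/2)(1 - e^{2·s2})) with initial data p̃2(0) < 0 and s2(0) < 0. Then there exists a finite time t* > 0 in the domain of the solution such that p̃2(t*) = 0; moreover s2(t) < 0 for all t ∈ [0, t*]. -/
open Real Set

open Filter Topology

/-- A solution of an autonomous `C¹` ODE on `[a, b)` with a limit at `b` extends past `b`. -/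
lemma exists_extension_of_tendsto_nhdsLT {E : Type*} [NormedAddCommGroup E] [NormedSpace ℝ E]
    [CompleteSpace E] {f : E → E} (hf : ContDiff ℝ 1 f) {x : ℝ → E} {a b : ℝ} (hab : a < b)
    (hx : ∀ t ∈ Ico a b, HasDerivAt x (f (x t)) t) {l : E} (hl : Tendsto x (𝓝[<] b) (𝓝 l)) :
    ∃ ε > 0, ∃ y : ℝ → E, (∀ t < b, y t = x t) ∧
      ∀ t ∈ Ico a (b + ε), HasDerivAt y (f (y t)) t := by
  obtain ⟨z, hz, ε, hε, hzd⟩ :=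
    hf.contDiffAt.exists_forall_mem_closedBall_exists_eq_forall_mem_Ioo_hasDerivAt₀
      (x₀ := l) b
  set y : ℝ → E := fun t => if t < b then x t else z t with hy
  have hyx : ∀ t < b, y t = x t := fun t ht => if_pos ht
  have hyz : ∀ t, b ≤ t → y t = z t := fun t ht => if_neg ht.not_gt
  have hyb : y b = l := (hyz b le_rfl).trans hz
  have hlt : ∀ t ∈ Ico a b, HasDerivAt y (f (y t)) t := fun t ht => by
    rw [hyx t ht.2]
    exact (hx t ht).congr_of_eventuallyEq ((eventually_lt_nhds ht.2).mono hyx)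
  refine ⟨ε, hε, y, hyx, fun t ht => ?_⟩
  rcases lt_trichotomy t b with h | rfl | h
  · exact hlt t ⟨ht.1, h⟩
  · have hylim : Tendsto y (𝓝[<] t) (𝓝 l) :=
      hl.congr' (eventually_nhdsWithin_of_forall fun u hu => (hyx u hu).symm)
    have hmem : Ioo a t ∈ 𝓝[<] t := Ioo_mem_nhdsLT hab
    have hleft : HasDerivWithinAt y (f (y t)) (Iic t) t := by
      refine hasDerivWithinAt_Iic_of_tendsto_deriv (s := Ioo a t)
        (fun u hu => (hlt u ⟨hu.1.le, hu.2⟩).differentiableAt.differentiableWithinAt) ?_ hmem ?_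
      · rw [ContinuousWithinAt, hyb]
        exact hylim.mono_left (nhdsWithin_mono _ Ioo_subset_Iio_self)
      · rw [hyb]
        refine ((hf.continuous.tendsto l).comp hylim).congr' ?_
        filter_upwards [hmem] with u hu
        exact (hlt u ⟨hu.1.le, hu.2⟩).deriv.symm
    have hright : HasDerivWithinAt y (f (y t)) (Ici t) t := by
      rw [hyz t le_rfl]
      exact (hzd t ⟨by linarith, by linarith⟩).hasDerivWithinAt.congr
        (fun u hu => hyz u hu) (hyz t le_rfl)
    simpa using hleft.union hright
  · rw [hyz t h.le]
    exact (hzd t ⟨by linarith, ht.2⟩).congr_of_eventuallyEq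
      ((eventually_gt_nhds h).mono fun u hu => hyz u (le_of_lt hu))

lemma neg_of_forall_ne_zero {p : ℝ → ℝ} {a b : ℝ} (hab : a ≤ b) (hp : ContinuousOn p (Icc a b))
    (ha : p a < 0) (hne : ∀ t ∈ Icc a b, p t ≠ 0) : p b < 0 := by
  by_contra! hb
  obtain ⟨t, ht, h0⟩ := intermediate_value_Icc hab hp ⟨ha.le, hb⟩
  exact hne t ht h0

lemma mul_sub_le_image_sub_of_hasDerivAt {f f' : ℝ → ℝ} {a b C : ℝ} (hab : a ≤ b)
    (hf : ∀ t ∈ Icc a b, HasDerivAt f (f' t) t) (hC : ∀ t ∈ Icc a b, C ≤ f' t) :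
    C * (b - a) ≤ f b - f a := by
  refine (convex_Icc a b).mul_sub_le_image_sub_of_le_deriv (HasDerivAt.continuousOn hf)
    (fun t ht => (hf t (interior_subset ht)).differentiableAt.differentiableWithinAt)
    (fun t ht => ?_) a (left_mem_Icc.2 hab) b (right_mem_Icc.2 hab) hab
  rw [(hf t (interior_subset ht)).deriv]
  exact hC t (interior_subset ht)

lemma separation_le_initial {p s : ℝ → ℝ} {b : ℝ}
    (hs : ∀ t ∈ Icc 0 b, HasDerivAt s (p t / 2 * (1 - Real.exp (2 * s t))) t)
    (hp : ∀ t ∈ Ico 0 b, p t < 0) (hs0 : s 0 < 0) : ∀ t ∈ Icc 0 b, s t ≤ s 0 := by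
  refine image_le_of_deriv_right_lt_deriv_boundary (B' := fun _ => 0) (HasDerivAt.continuousOn hs)
    (fun t ht => (hs t (Ico_subset_Icc_self ht)).hasDerivWithinAt) le_rfl
    (fun t => hasDerivAt_const t (s 0)) fun t ht heq => ?_
  have : Real.exp (2 * s t) < 1 := Real.exp_lt_one_iff.2 (by linarith)
  exact mul_neg_of_neg_of_pos (by linarith [hp t ht]) (by linarith)

/-- for the maximal solution of the reduced system with constant control
`a1 = -c²/2` and initial data `p̃2(0) < 0`, `s2(0) < 0`, there is a finite time
`t* > 0` in the domain of the solution at which `p̃2(t*) = 0`, and `s2 < 0` on `[0,t*]`.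
Maximality is expressed by the non-existence of a proper extension of the solution. -/
theorem reduced_system_p2_hits_zero
    (c : ℝ) (hc : c ≠ 0)
    (p s : ℝ → ℝ) (T : EReal) (hT : 0 < T)
    (hsol : ∀ t : ℝ, 0 ≤ t → (t : EReal) < T →
      HasDerivAt p ((1/2) * ((p t)^2 - c^2) * Real.exp (2 * s t) + c^2 / 2) t ∧
      HasDerivAt s (p t / 2 * (1 - Real.exp (2 * s t))) t)
    (hp0 : p 0 < 0) (hs0 : s 0 < 0)
    (hmax : ∀ (p' s' : ℝ → ℝ) (T' : EReal), T < T' →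
      (∀ t : ℝ, 0 ≤ t → (t : EReal) < T' →
        HasDerivAt p' ((1/2) * ((p' t)^2 - c^2) * Real.exp (2 * s' t) + c^2 / 2) t ∧
        HasDerivAt s' (p' t / 2 * (1 - Real.exp (2 * s' t))) t) →
      (∀ t : ℝ, 0 ≤ t → (t : EReal) < T → p' t = p t ∧ s' t = s t) → False) :
    ∃ tstar : ℝ, 0 < tstar ∧ (tstar : EReal) < T ∧ p tstar = 0 ∧
      ∀ t ∈ Icc (0:ℝ) tstar, s t < 0 := by
  have hdom : ∀ {u v : ℝ}, u ≤ v → (v : EReal) < T → (u : EReal) < T := fun huv hv =>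
    (EReal.coe_le_coe_iff.2 huv).trans_lt hv
  have hpc : ∀ b : ℝ, (b : EReal) < T → ContinuousOn p (Icc 0 b) := fun b hb =>
    HasDerivAt.continuousOn fun t ht => (hsol t ht.1 (hdom ht.2 hb)).1
  by_cases hzero : ∃ t : ℝ, 0 < t ∧ (t : EReal) < T ∧ p t = 0
  · obtain ⟨t₁, ht₁, ht₁T, hpt₁⟩ := hzero
    have hcomp : IsCompact (Icc 0 t₁ ∩ p ⁻¹' {0}) :=
      isCompact_Icc.of_isClosed_subset
        ((hpc t₁ ht₁T).preimage_isClosed_of_isClosed isClosed_Icc isClosed_singleton)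
        inter_subset_left
    obtain ⟨τ, ⟨hτ, hpτ⟩, hleast⟩ := hcomp.exists_isLeast ⟨t₁, ⟨ht₁.le, le_rfl⟩, hpt₁⟩
    have hτT : (τ : EReal) < T := hdom hτ.2 ht₁T
    have hpτ : p τ = 0 := hpτ
    have hneg : ∀ t ∈ Ico 0 τ, p t < 0 := fun t ht =>
      neg_of_forall_ne_zero ht.1 (hpc t (hdom ht.2.le hτT)) hp0 fun u hu hu0 =>
        (hleast ⟨⟨hu.1, by linarith [hu.2, ht.2, hτ.2]⟩, hu0⟩).not_gt (hu.2.trans_lt ht.2)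
    refine ⟨τ, hτ.1.lt_of_ne ?_, hτT, hpτ, fun t ht =>
      (separation_le_initial (fun u hu => (hsol u hu.1 (hdom hu.2 hτT)).2) hneg hs0 t ht).trans_lt
        hs0⟩
    rintro rfl
    exact hp0.ne hpτ
  · exfalso
    push Not at hzero
    have hneg : ∀ t : ℝ, 0 ≤ t → (t : EReal) < T → p t < 0 := fun t ht htT =>
      neg_of_forall_ne_zero ht (hpc t htT) hp0 fun u hu => by
        rcases hu.1.eq_or_lt with rfl | h
        · exact hp0.ne
        · exact hzero u h (hdom hu.2 htT)
    have hsle : ∀ t : ℝ, 0 ≤ t → (t : EReal) < T → s t ≤ s 0 := fun t ht htT =>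
      separation_le_initial (fun u hu => (hsol u hu.1 (hdom hu.2 htT)).2)
        (fun u hu => hneg u hu.1 (hdom hu.2.le htT)) hs0 t ⟨ht, le_rfl⟩
    set δ := c ^ 2 / 2 * (1 - Real.exp (2 * s 0)) with hδ
    have hδ0 : 0 < δ := by
      have : Real.exp (2 * s 0) < 1 := Real.exp_lt_one_iff.2 (by linarith)
      have : 0 < c ^ 2 := by positivity
      exact mul_pos (by linarith) (by linarith)
    have hp' : ∀ t : ℝ, 0 ≤ t → (t : EReal) < T →
        δ ≤ (1/2) * ((p t)^2 - c^2) * Real.exp (2 * s t) + c^2 / 2 := fun t ht htT => by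
      have h1 : Real.exp (2 * s t) ≤ Real.exp (2 * s 0) :=
        Real.exp_le_exp.2 (by linarith [hsle t ht htT])
      have h2 : 0 ≤ p t ^ 2 * Real.exp (2 * s t) := by positivity
      nlinarith [mul_le_mul_of_nonneg_left h1 (sq_nonneg c)]
    have hpmono : ∀ u v : ℝ, 0 ≤ u → u ≤ v → (v : EReal) < T → δ * (v - u) ≤ p v - p u :=
      fun u v hu huv hv => mul_sub_le_image_sub_of_hasDerivAt huv
        (fun t ht => (hsol t (hu.trans ht.1) (hdom ht.2 hv)).1)
        (fun t ht => hp' t (hu.trans ht.1) (hdom ht.2 hv))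
    have hTle : T ≤ ((-p 0 / δ : ℝ) : EReal) := by
      by_contra! h
      have hnn : 0 ≤ -p 0 / δ := div_nonneg (by linarith) hδ0.le
      have h1 := hpmono 0 _ le_rfl hnn h
      have h2 := hneg _ hnn h
      rw [sub_zero, mul_div_cancel₀ _ hδ0.ne'] at h1
      linarith
    lift T to ℝ using ⟨(hTle.trans_lt (EReal.coe_lt_top _)).ne, (EReal.bot_lt_zero.trans hT).ne'⟩
    simp only [EReal.coe_lt_coe_iff] at *
    have hT : 0 < T := by exact_mod_cast hT
    have hs'nonpos : ∀ t, 0 ≤ t → t < T → p t / 2 * (1 - Real.exp (2 * s t)) ≤ 0 :=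
      fun t ht htT => by
        have : Real.exp (2 * s t) ≤ 1 := Real.exp_le_one_iff.2 (by linarith [hsle t ht htT])
        exact mul_nonpos_of_nonpos_of_nonneg (by linarith [hneg t ht htT]) (by linarith)
    have hs'ge : ∀ t, 0 ≤ t → t < T → p 0 / 2 ≤ p t / 2 * (1 - Real.exp (2 * s t)) :=
      fun t ht htT => by
        have h1 := hpmono 0 t le_rfl ht htT
        have h2 : 0 ≤ δ * (t - 0) := mul_nonneg hδ0.le (by linarith)
        nlinarith [mul_nonneg (neg_pos.2 (hneg t ht htT)).le (Real.exp_pos (2 * s t)).le]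
    have hplim := MonotoneOn.tendsto_nhdsWithin_Ioo_left (f := p) (nonempty_Ioo.2 hT)
      (fun u hu v hv huv => by
        have := hpmono u v hu.1.le huv hv.2
        nlinarith [mul_nonneg hδ0.le (sub_nonneg.2 huv)])
      ⟨0, by rintro _ ⟨t, ht, rfl⟩; exact (hneg t ht.1.le ht.2).le⟩
    have hslim := AntitoneOn.tendsto_nhdsWithin_Ioo_left (f := s) (nonempty_Ioo.2 hT)
      (fun u hu v hv huv => by
        have := mul_sub_le_image_sub_of_hasDerivAt (f := fun t => -s t) (C := 0) huv
          (fun t ht => (hsol t (hu.1.le.trans ht.1) (ht.2.trans_lt hv.2)).2.fun_neg)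
          (fun t ht => neg_nonneg.2 (hs'nonpos t (hu.1.le.trans ht.1) (ht.2.trans_lt hv.2)))
        linarith)
      ⟨s 0 + p 0 / 2 * T, by
        rintro _ ⟨t, ht, rfl⟩
        have := mul_sub_le_image_sub_of_hasDerivAt ht.1.le
          (fun u hu => (hsol u hu.1 (hu.2.trans_lt ht.2)).2)
          (fun u hu => hs'ge u hu.1 (hu.2.trans_lt ht.2))
        nlinarith [ht.2]⟩
    let F : ℝ × ℝ → ℝ × ℝ := fun z =>
      ((1/2) * (z.1 ^ 2 - c ^ 2) * Real.exp (2 * z.2) + c ^ 2 / 2,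
        z.1 / 2 * (1 - Real.exp (2 * z.2)))
    have hF : ContDiff ℝ 1 F := by fun_prop
    obtain ⟨ε, hε, y, hyx, hyd⟩ := exists_extension_of_tendsto_nhdsLT hF
      (x := fun t => (p t, s t)) hT
      (fun t ht => (hsol t ht.1 ht.2).1.prodMk (hsol t ht.1 ht.2).2) (hplim.prodMk_nhds hslim)
    refine hmax (fun t => (y t).1) (fun t => (y t).2) ((T + ε : ℝ) : EReal)
      (EReal.coe_lt_coe_iff.2 (by linarith)) (fun t ht htT => ?_) fun t _ htT => by simp [hyx t htT]
    have hy := hyd t ⟨ht, EReal.coe_lt_coe_iff.1 htT⟩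
    exact ⟨(hasFDerivAt_fst (p := y t)).comp_hasDerivAt t hy,
      (hasFDerivAt_snd (p := y t)).comp_hasDerivAt t hy⟩
end

section
/- Let c ∈ ℝ and let (p̃2, s2) solve the reduced system with constant control a1 = -c²/2 on an interval [t̄, t], with s2 ≤ 0 on [t̄, t], p̃2(t̄) > 0, and t - t̄ < 2·e^{-2·s2(t̄)}/p̃2(t̄). Then p̃2(t) ≥ 1 / ( 1/p̃2(t̄) - (1/2)·e^{2·s2(t̄)}·(t - t̄) ). -/
open Real Set

/-- A function with nonnegative derivative on a closed interval is monotone there. -/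
theorem monotoneOn_Icc_of_hasDerivAt_nonneg {f f' : ℝ → ℝ} {a b : ℝ}
    (hf : ∀ u ∈ Icc a b, HasDerivAt f (f' u) u) (hf' : ∀ u ∈ Icc a b, 0 ≤ f' u) :
    MonotoneOn f (Icc a b) :=
  monotoneOn_of_hasDerivWithinAt_nonneg (convex_Icc a b)
    (fun u hu => (hf u hu).continuousAt.continuousWithinAt)
    (fun u hu => (hf u (interior_subset hu)).hasDerivWithinAt)
    (fun u hu => hf' u (interior_subset hu))

/-- lower bound on `p̃2` for the reduced system with constant control
`a1 = -c²/2`, valid as long as `t - t̄ < 2 e^{-2 s2(t̄)} / p̃2(t̄)`. -/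
theorem reduced_system_p2_lower_bound
    (c tb t : ℝ) (htt : tb ≤ t)
    (p s : ℝ → ℝ)
    (hp : ∀ u ∈ Icc tb t,
      HasDerivAt p ((1/2) * ((p u)^2 - c^2) * Real.exp (2 * s u) + c^2 / 2) u)
    (hs : ∀ u ∈ Icc tb t,
      HasDerivAt s (p u / 2 * (1 - Real.exp (2 * s u))) u)
    (hsneg : ∀ u ∈ Icc tb t, s u ≤ 0)
    (hpb : 0 < p tb)
    (htb : t - tb < 2 * Real.exp (-2 * s tb) / p tb) :
    1 / (1 / p tb - (1/2) * Real.exp (2 * s tb) * (t - tb)) ≤ p t := by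
  have left_mem : tb ∈ Icc tb t := left_mem_Icc.2 htt
  have right_mem : t ∈ Icc tb t := right_mem_Icc.2 htt
  have exp_le : ∀ u ∈ Icc tb t, Real.exp (2 * s u) ≤ 1 := fun u hu =>
    Real.exp_le_one_iff.2 (by linarith [hsneg u hu])
  have p_mono : MonotoneOn p (Icc tb t) := by
    refine monotoneOn_Icc_of_hasDerivAt_nonneg hp fun u hu => ?_
    nlinarith [mul_nonneg (sq_nonneg (p u)) (Real.exp_pos (2 * s u)).le,
      mul_nonneg (sq_nonneg c) (sub_nonneg.2 (exp_le u hu))]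
  have p_pos : ∀ u ∈ Icc tb t, 0 < p u := fun u hu =>
    hpb.trans_le (p_mono left_mem hu hu.1)
  have s_mono : MonotoneOn s (Icc tb t) :=
    monotoneOn_Icc_of_hasDerivAt_nonneg hs fun u hu =>
      mul_nonneg (half_pos (p_pos u hu)).le (sub_nonneg.2 (exp_le u hu))
  have exp_ge : ∀ u ∈ Icc tb t, Real.exp (2 * s tb) ≤ Real.exp (2 * s u) := fun u hu =>
    Real.exp_le_exp.2 (by linarith [s_mono left_mem hu hu.1])
  have key : MonotoneOn (fun u => -(p u)⁻¹ - (1/2) * Real.exp (2 * s tb) * u) (Icc tb t) := by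
    refine monotoneOn_Icc_of_hasDerivAt_nonneg (fun u hu =>
      ((hp u hu).fun_inv (p_pos u hu).ne').fun_neg.sub
        ((hasDerivAt_id u).const_mul ((1/2) * Real.exp (2 * s tb)))) fun u hu => ?_
    have hsq : 0 < p u ^ 2 := pow_pos (p_pos u hu) 2
    rw [sub_nonneg, neg_div, neg_neg, le_div_iff₀ hsq]
    nlinarith [mul_nonneg hsq.le (sub_nonneg.2 (exp_ge u hu)),
      mul_nonneg (sq_nonneg c) (sub_nonneg.2 (exp_le u hu))]
  have hle := key left_mem right_mem htt
  simp only at hle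
  rw [one_div, one_div]
  exact inv_le_of_inv_le₀ (p_pos t right_mem) (by linarith)
end

section
/- Let c ∈ ℝ and let (p̃2, s2) solve the reduced system with constant control a1 = -c²/2 on an interval [t̄, t], with s2 ≤ 0 on [t̄, t], p̃2(t̄) > 0, and t - t̄ < 2·e^{-2·s2(t̄)}/p̃2(t̄). Then e^{-2·s2(t)} - 1 ≤ (e^{-2·s2(t̄)} - 1) · ( 1 - (1/2)·p̃2(t̄)·e^{2·s2(t̄)}·(t - t̄) )^{2·e^{-2·s2(t̄)}}. -/
open Real Set

/-- A function with a nonpositive derivative on `[a, b]` is antitone there. -/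
theorem antitoneOn_Icc_of_hasDerivAt_nonpos {f f' : ℝ → ℝ} {a b : ℝ}
    (hf : ∀ u ∈ Icc a b, HasDerivAt f (f' u) u) (hf' : ∀ u ∈ Icc a b, f' u ≤ 0) :
    AntitoneOn f (Icc a b) := by
  have h := monotoneOn_Icc_of_hasDerivAt_nonneg (fun u hu => (hf u hu).neg)
    (fun u hu => neg_nonneg.2 (hf' u hu))
  exact fun x hx y hy hxy => neg_le_neg_iff.1 (h hx hy hxy)

/-- Riccati comparison: a function with `p' ≥ k p²` and `p ≥ p(a) > 0` lies above the solution
`p(a) / (1 - k p(a) (u - a))` of the Riccati equation. -/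
theorem le_mul_one_sub_of_riccati {p p' : ℝ → ℝ} {a b k : ℝ} (hpa : 0 < p a)
    (hp : ∀ u ∈ Icc a b, HasDerivAt p (p' u) u) (hpos : ∀ u ∈ Icc a b, p a ≤ p u)
    (hk : ∀ u ∈ Icc a b, k * p u ^ 2 ≤ p' u) {u : ℝ} (hu : u ∈ Icc a b) :
    p a ≤ p u * (1 - k * p a * (u - a)) := by
  have hanti : AntitoneOn (fun v => (p v)⁻¹ + k * v) (Icc a b) := by
    refine antitoneOn_Icc_of_hasDerivAt_nonpos (f' := fun v => -p' v / p v ^ 2 + k * 1)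
      (fun v hv => ((hp v hv).inv (hpa.trans_le (hpos v hv)).ne').add
        ((hasDerivAt_id v).const_mul k)) (fun v hv => ?_)
    have hv0 : 0 < p v ^ 2 := pow_pos (hpa.trans_le (hpos v hv)) 2
    have := (le_div_iff₀ hv0).2 (hk v hv)
    rw [neg_div]
    linarith
  have hu0 : 0 < p u := hpa.trans_le (hpos u hu)
  have h : (p u)⁻¹ + k * u ≤ (p a)⁻¹ + k * a :=
    hanti (left_mem_Icc.2 (hu.1.trans hu.2)) hu hu.1
  have h1 := mul_le_mul_of_nonneg_left h (mul_pos hpa hu0).le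
  have e1 : p a * p u * ((p u)⁻¹ + k * u) = p a + p a * p u * (k * u) := by
    field_simp
  have e2 : p a * p u * ((p a)⁻¹ + k * a) = p u + p a * p u * (k * a) := by
    field_simp
  rw [e1, e2] at h1
  linarith

/-- key inequality (4.18)-(3.18) for the reduced system with constant
control `a1 = -c²/2`:
`e^{-2 s2(t)} - 1 ≤ (e^{-2 s2(t̄)} - 1) (1 - (1/2) p̃2(t̄) e^{2 s2(t̄)} (t - t̄))^{2 e^{-2 s2(t̄)}}`. -/
theorem reduced_system_collision_inequality
    (c tb t : ℝ) (htt : tb ≤ t)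
    (p s : ℝ → ℝ)
    (hp : ∀ u ∈ Icc tb t,
      HasDerivAt p ((1/2) * ((p u)^2 - c^2) * Real.exp (2 * s u) + c^2 / 2) u)
    (hs : ∀ u ∈ Icc tb t,
      HasDerivAt s (p u / 2 * (1 - Real.exp (2 * s u))) u)
    (hsneg : ∀ u ∈ Icc tb t, s u ≤ 0)
    (hpb : 0 < p tb)
    (htb : t - tb < 2 * Real.exp (-2 * s tb) / p tb) :
    Real.exp (-2 * s t) - 1 ≤
      (Real.exp (-2 * s tb) - 1) *
        (1 - (1/2) * p tb * Real.exp (2 * s tb) * (t - tb))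
          ^ (2 * Real.exp (-2 * s tb)) := by
  have htbm : tb ∈ Icc tb t := left_mem_Icc.2 htt
  have hE1 : ∀ u ∈ Icc tb t, exp (2 * s u) ≤ 1 := fun u hu =>
    exp_le_one_iff.2 (by linarith [hsneg u hu])
  have hpmono : MonotoneOn p (Icc tb t) := by
    refine monotoneOn_Icc_of_hasDerivAt_nonneg hp fun u hu => ?_
    nlinarith [hE1 u hu, mul_nonneg (sq_nonneg (p u)) (exp_pos (2 * s u)).le,
      mul_nonneg (sq_nonneg c) (sub_nonneg.2 (hE1 u hu))]
  have hple : ∀ u ∈ Icc tb t, p tb ≤ p u := fun u hu => hpmono htbm hu hu.1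
  have hsmono : MonotoneOn s (Icc tb t) :=
    monotoneOn_Icc_of_hasDerivAt_nonneg hs fun u hu =>
      mul_nonneg (by linarith [hple u hu]) (sub_nonneg.2 (hE1 u hu))
  set k : ℝ := 1 / 2 * exp (2 * s tb) with hk
  set r : ℝ := 2 * exp (-2 * s tb) with hr
  have hkpos : 0 < k := by positivity
  have hkr : k * r = 1 := by
    have : exp (2 * s tb) * exp (-2 * s tb) = 1 := by
      rw [← exp_add, show 2 * s tb + -2 * s tb = 0 by ring, exp_zero]
    rw [hk, hr]
    linarith
  have hric : ∀ u ∈ Icc tb t, p tb ≤ p u * (1 - k * p tb * (u - tb)) := fun u hu => by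
    refine le_mul_one_sub_of_riccati hpb hp hple (fun v hv => ?_) hu
    have hEle : exp (2 * s tb) ≤ exp (2 * s v) :=
      exp_le_exp.2 (by linarith [hsmono htbm hv hv.1])
    nlinarith [mul_nonneg (sq_nonneg (p v)) (sub_nonneg.2 hEle),
      mul_nonneg (sq_nonneg c) (sub_nonneg.2 (hE1 v hv))]
  have hD : ∀ u ∈ Icc tb t, 0 < 1 - k * p tb * (u - tb) := fun u hu =>
    pos_of_mul_pos_right (hpb.trans_le (hric u hu)) (hpb.le.trans (hple u hu))
  have hanti : AntitoneOn
      (fun u => (exp (-2 * s u) - 1) * (1 - k * p tb * (u - tb)) ^ (-r)) (Icc tb t) := by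
    refine antitoneOn_Icc_of_hasDerivAt_nonpos
      (f' := fun u => (exp (-2 * s u) * (-2 * (p u / 2 * (1 - exp (2 * s u))))) *
          (1 - k * p tb * (u - tb)) ^ (-r) +
        (exp (-2 * s u) - 1) *
          (-(k * p tb * 1) * (-r) * (1 - k * p tb * (u - tb)) ^ (-r - 1)))
      (fun u hu => ?_) (fun u hu => ?_)
    · exact (((hs u hu).const_mul (-2)).exp.sub_const 1).mul
        (((((hasDerivAt_id u).sub_const tb).const_mul (k * p tb)).const_sub 1).rpow_const
          (Or.inl (hD u hu).ne'))
    · have hw : 0 ≤ exp (-2 * s u) - 1 :=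
        sub_nonneg.2 (one_le_exp_iff.2 (by linarith [hsneg u hu]))
      have hEE : exp (-2 * s u) * exp (2 * s u) = 1 := by
        rw [← exp_add, show -2 * s u + 2 * s u = 0 by ring, exp_zero]
      have hpow : (1 - k * p tb * (u - tb)) ^ (-r) =
          (1 - k * p tb * (u - tb)) ^ (-r - 1) * (1 - k * p tb * (u - tb)) := by
        rw [← rpow_add_one (hD u hu).ne', sub_add_cancel]
      have hfac : exp (-2 * s u) * (-2 * (p u / 2 * (1 - exp (2 * s u)))) =
          -(p u * (exp (-2 * s u) - 1)) := by
        linear_combination p u * hEE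
      have hcoef : -(k * p tb * 1) * (-r) = p tb := by
        linear_combination p tb * hkr
      rw [hfac, hcoef, hpow]
      have := mul_nonneg (mul_nonneg hw (rpow_nonneg (hD u hu).le (-r - 1)))
        (sub_nonneg.2 (hric u hu))
      linarith
  have hfin := hanti htbm (right_mem_Icc.2 htt) htt
  have hDt := hD t (right_mem_Icc.2 htt)
  simp only [sub_self, mul_zero, sub_zero, one_rpow, mul_one, rpow_neg hDt.le] at hfin
  rw [show 1 / 2 * p tb * exp (2 * s tb) * (t - tb) = k * p tb * (t - tb) by rw [hk]; ring]
  rwa [← div_eq_mul_inv, div_le_iff₀ (rpow_pos_of_pos hDt r)] at hfin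
end

section
/- (Controllability of collision, reduced form.) Let c ∈ ℝ with c ≠ 0, let α ≥ c²/2, and fix initial data p̃2(0) = p̃2* ∈ ℝ and s2(0) = s2* < 0. Then the constant control a1 ≡ -c²/2 (which satisfies |a1| ≤ α) steers the reduced system to a collision in finite time: the corresponding solution of p̃2' = (1/2)(p̃2² - c²)·e^{2·s2} + c²/2, s2' = (p̃2/2)(1 - e^{2·s2}) satisfies s2(t) < 0 for t < τ and s2(t) → 0 as t → τ for some finite τ > 0. Moreover, if t̄ is any time with p̃2(t̄) > 0 and s2(t̄) < 0, then τ ≤ t̄ + 2·e^{-2·s2(t̄)}/p̃2(t̄). -/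
open Real Set Filter Topology

open scoped Manifold NNReal

/-- A scalar second-order equation `x'' = g x` with `g` bounded and `C¹` has global solutions. -/
theorem exists_global_solution_second_order {g : ℝ → ℝ} (hg : ContDiff ℝ 1 g) {M : ℝ}
    (hM : ∀ x, |g x| ≤ M) (x₀ y₀ : ℝ) :
    ∃ x y : ℝ → ℝ, x 0 = x₀ ∧ y 0 = y₀ ∧
      (∀ t, HasDerivAt x (y t) t) ∧ ∀ t, HasDerivAt y (g (x t)) t := by
  set F : ℝ × ℝ → ℝ × ℝ := fun z ↦ (z.2, g z.1) with hF
  have hFd : ContDiff ℝ 1 F := by fun_prop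
  have hM0 : 0 ≤ M := (abs_nonneg _).trans (hM 0)
  have hlocal : ∀ z : ℝ × ℝ, ∃ γ : ℝ → ℝ × ℝ, γ 0 = z ∧
      IsMIntegralCurveOn (I := 𝓘(ℝ, ℝ × ℝ)) γ F (Ioo (-(1 / 2 : ℝ)) (1 / 2)) := by
    intro z
    set a : ℝ≥0 := ⟨|z.2| + M, by positivity⟩
    obtain ⟨K, hK⟩ := (hFd.locallyLipschitz.locallyLipschitzOn (s := Metric.closedBall z a)
      ).exists_lipschitzOnWith_of_compact (isCompact_closedBall z a)
    have hbound : ∀ w ∈ Metric.closedBall z a, ‖F w‖ ≤ (2 * a : ℝ≥0) := by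
      intro w hw
      have hw2 : |w.2 - z.2| ≤ a := by
        have h := (norm_snd_le (w - z)).trans (mem_closedBall_iff_norm.mp hw)
        simpa using h
      have hac : (a : ℝ) = |z.2| + M := rfl
      have h1 := abs_sub_abs_le_abs_sub w.2 z.2
      have h2 := abs_nonneg z.2
      simp only [hF, Prod.norm_def, Real.norm_eq_abs, max_le_iff, NNReal.coe_mul,
        NNReal.coe_ofNat]
      constructor
      · linarith
      · linarith [hM w.1]
    have hPL : IsPicardLindelof (fun _ ↦ F) (tmin := -(1 / 2)) (tmax := 1 / 2)
        ⟨0, by norm_num, by norm_num⟩ z a 0 (2 * a) K := by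
      refine IsPicardLindelof.of_time_independent hbound hK ?_
      norm_num
      linarith
    obtain ⟨γ, hγ0, hγ⟩ := hPL.exists_eq_forall_mem_Icc_hasDerivWithinAt₀
    refine ⟨γ, hγ0, fun t ht ↦ ?_⟩
    exact ((hγ t (Ioo_subset_Icc_self ht)).mono
      Ioo_subset_Icc_self).hasFDerivWithinAt.hasMFDerivWithinAt
  obtain ⟨γ, hγ0, hγ⟩ := exists_isMIntegralCurve_of_isMIntegralCurveOn (I := 𝓘(ℝ, ℝ × ℝ)) (v := F)
    (contMDiff_vectorSpace_iff_contDiff.mpr hFd) (half_pos one_pos) hlocal (x₀, y₀)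
  have hγd : ∀ t, HasDerivAt γ (F (γ t)) t := fun t ↦ by
    have h : HasFDerivAt γ ((1 : ℝ →L[ℝ] ℝ).smulRight (F (γ t))) t := (hγ t).hasFDerivAt
    simpa using h.hasDerivAt
  refine ⟨fun t ↦ (γ t).1, fun t ↦ (γ t).2, by simp [hγ0], by simp [hγ0], fun t ↦ ?_, fun t ↦ ?_⟩
  · exact hasFDerivAt_fst.comp_hasDerivAt t (hγd t)
  · exact hasFDerivAt_snd.comp_hasDerivAt t (hγd t)

/-- A function with antitone derivative lies below its tangent lines. -/
theorem le_tangent_of_antitoneOn_deriv {x y : ℝ → ℝ} {a b : ℝ} (hab : a ≤ b)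
    (hx : ∀ t, HasDerivAt x (y t) t) (hy : AntitoneOn y (Icc a b)) :
    x b ≤ x a + y a * (b - a) := by
  have h : AntitoneOn (fun t ↦ x t - y a * t) (Icc a b) := by
    refine antitoneOn_of_hasDerivWithinAt_nonpos (f' := fun t ↦ y t - y a * 1) (convex_Icc a b)
      (fun t _ ↦ ((hx t).sub ((hasDerivAt_id t).const_mul _)).continuousAt.continuousWithinAt)
      (fun t _ ↦ ((hx t).sub ((hasDerivAt_id t).const_mul _)).hasDerivWithinAt) fun t ht ↦ ?_
    have ht' := interior_subset ht
    linarith [hy (left_mem_Icc.mpr hab) ht' ht'.1]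
  have := h (left_mem_Icc.mpr hab) (right_mem_Icc.mpr hab) hab
  simp only at this
  linarith

/-- A particle on the positive half-line pushed towards the origin by a monotone force
reaches the origin in finite time, and its velocity decreases until then. -/
theorem exists_first_zero_of_attracting {g x y : ℝ → ℝ} (hg : Monotone g)
    (hgpos : ∀ u, 0 < u → 0 < g u) (hx : ∀ t, HasDerivAt x (y t) t)
    (hy : ∀ t, HasDerivAt y (-g (x t)) t) (hx0 : 0 < x 0) :
    ∃ τ, 0 < τ ∧ x τ = 0 ∧ (∀ t ∈ Ico 0 τ, 0 < x t) ∧ AntitoneOn y (Icc 0 τ) := by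
  have hxc : Continuous x := continuous_iff_continuousAt.mpr fun t ↦ (hx t).continuousAt
  have hyc : Continuous y := continuous_iff_continuousAt.mpr fun t ↦ (hy t).continuousAt
  have hne : ∃ t, 0 ≤ t ∧ x t ≤ 0 := by
    by_contra! hpos
    have hanti : AntitoneOn y (Ici 0) :=
      antitoneOn_of_hasDerivWithinAt_nonpos (convex_Ici 0) hyc.continuousOn
        (fun t _ ↦ (hy t).hasDerivWithinAt)
        fun t ht ↦ neg_nonpos.mpr (hgpos _ (hpos t (interior_subset ht))).le
    by_cases hneg : ∃ t, 0 ≤ t ∧ y t < 0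
    · obtain ⟨t, ht, hyt⟩ := hneg
      have hle : t ≤ t + x t / (-y t) :=
        le_add_of_nonneg_right (div_nonneg (hpos t ht).le (by linarith))
      have h := le_tangent_of_antitoneOn_deriv hle hx
        (hanti.mono fun u hu ↦ ht.trans hu.1)
      have heq : x t + y t * (t + x t / (-y t) - t) = 0 := by
        field_simp [hyt.ne]
        ring
      linarith [hpos _ (ht.trans hle)]
    · push Not at hneg
      have hmono : MonotoneOn x (Ici 0) :=
        monotoneOn_of_hasDerivWithinAt_nonneg (convex_Ici 0) hxc.continuousOn
          (fun t _ ↦ (hx t).hasDerivWithinAt) fun t ht ↦ hneg t (interior_subset ht)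
      have hc := hgpos _ hx0
      have hlin : AntitoneOn (fun t ↦ y t + g (x 0) * t) (Ici 0) := by
        refine antitoneOn_of_hasDerivWithinAt_nonpos (f' := fun t ↦ -g (x t) + g (x 0) * 1)
          (convex_Ici 0) (by fun_prop)
          (fun t _ ↦ ((hy t).add ((hasDerivAt_id t).const_mul _)).hasDerivWithinAt) fun t ht ↦ ?_
        have ht' := interior_subset ht
        linarith [hg (hmono self_mem_Ici ht' ht')]
      have hb : 0 ≤ (|y 0| + 1) / g (x 0) := by positivity
      have h := hlin self_mem_Ici hb hb
      simp only [mul_zero, add_zero, mul_div_cancel₀ _ hc.ne'] at h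
      linarith [hneg _ hb, le_abs_self (y 0)]
  set Z : Set ℝ := {t | 0 ≤ t ∧ x t ≤ 0}
  have hZc : IsClosed Z :=
    (isClosed_le continuous_const continuous_id).inter (isClosed_le hxc continuous_const)
  have hZb : BddBelow Z := ⟨0, fun t ht ↦ ht.1⟩
  obtain ⟨h0τ, hxτ⟩ : sInf Z ∈ Z := hZc.csInf_mem hne hZb
  set τ := sInf Z
  have hbefore : ∀ t ∈ Ico 0 τ, 0 < x t := fun t ht ↦ by
    by_contra! h
    exact (csInf_le hZb ⟨ht.1, h⟩).not_gt ht.2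
  have hτ : 0 < τ := h0τ.lt_of_ne fun h ↦ by rw [← h] at hxτ; linarith
  refine ⟨τ, hτ, hxτ.antisymm ?_, hbefore, ?_⟩
  · refine ge_of_tendsto (hxc.continuousAt.tendsto.mono_left nhdsWithin_le_nhds :
      Tendsto x (𝓝[<] τ) (𝓝 (x τ))) ?_
    filter_upwards [Ico_mem_nhdsLT hτ] with t ht using (hbefore t ht).le
  · refine antitoneOn_of_hasDerivWithinAt_nonpos (convex_Icc 0 τ) hyc.continuousOn
      (fun t _ ↦ (hy t).hasDerivWithinAt) fun t ht ↦ ?_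
    rw [interior_Icc] at ht
    exact neg_nonpos.mpr (hgpos _ (hbefore t ⟨ht.1.le, ht.2⟩)).le

theorem strictMono_tanh : StrictMono tanh := fun x y hxy ↦ by
  rw [tanh_eq_sinh_div_cosh, tanh_eq_sinh_div_cosh, div_lt_div_iff₀ (cosh_pos x) (cosh_pos y)]
  have h := sinh_pos_iff.mpr (sub_pos.mpr hxy)
  rw [sinh_sub] at h
  linarith

theorem tanh_pos_of_pos {x : ℝ} (hx : 0 < x) : 0 < tanh x := by
  simpa using strictMono_tanh hx

theorem contDiff_tanh {n : WithTop ℕ∞} : ContDiff ℝ n tanh := by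
  rw [show tanh = fun x ↦ sinh x / cosh x from funext tanh_eq_sinh_div_cosh]
  exact contDiff_sinh.div contDiff_cosh fun x ↦ (cosh_pos x).ne'

theorem exp_two_mul_neg_log_cosh (x : ℝ) : exp (2 * -log (cosh x)) = (cosh x ^ 2)⁻¹ := by
  rw [mul_neg, exp_neg, ← exp_log (pow_pos (cosh_pos x) 2), log_pow]
  norm_num

theorem neg_log_cosh_neg {x : ℝ} (hx : x ≠ 0) : -log (cosh x) < 0 :=
  neg_neg_of_pos (log_pos (one_lt_cosh.mpr hx))

/-- In the coordinate `x` with `s = -log (cosh x)`, the reduced system under the control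
`-c² / 2` becomes the scalar equation `x'' = -(c² / 4) tanh³ x`. -/
theorem hasDerivAt_reduced_system {c t : ℝ} {x y : ℝ → ℝ} (hx : HasDerivAt x (y t) t)
    (hy : HasDerivAt y (-(c ^ 2 / 4 * tanh (x t) ^ 3)) t) (hxt : 0 < x t) :
    HasDerivAt (fun t ↦ -2 * y t * cosh (x t) / sinh (x t))
      ((1 / 2) * ((-2 * y t * cosh (x t) / sinh (x t)) ^ 2 - c ^ 2) *
        exp (2 * -log (cosh (x t))) + c ^ 2 / 2) t ∧
    HasDerivAt (fun t ↦ -log (cosh (x t)))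
      (-2 * y t * cosh (x t) / sinh (x t) / 2 * (1 - exp (2 * -log (cosh (x t))))) t := by
  have hS : sinh (x t) ≠ 0 := (sinh_pos_iff.mpr hxt).ne'
  have hC : cosh (x t) ≠ 0 := (cosh_pos _).ne'
  have hCS := cosh_sq (x t)
  rw [exp_two_mul_neg_log_cosh]
  rw [tanh_eq_sinh_div_cosh] at hy
  constructor
  · refine (((hy.const_mul (-2)).mul hx.cosh).div hx.sinh hS).congr_deriv ?_
    simp only [Pi.mul_apply]
    field_simp
    linear_combination
      4 * (4 * cosh (x t) ^ 2 * y t ^ 2 - c ^ 2 * sinh (x t) ^ 2) * hCS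
  · refine (hx.cosh.log hC).neg.congr_deriv ?_
    field_simp
    rw [hCS]
    ring

/-- controllability of collision, reduced form: with `α ≥ c²/2`,
the admissible constant control `a1 ≡ -c²/2` steers the reduced system from any
initial data `(p̃2*, s2*)` with `s2* < 0` to a collision (`s2 → 0`) in finite time `τ`;
moreover `τ ≤ t̄ + 2 e^{-2 s2(t̄)}/p̃2(t̄)` whenever `p̃2(t̄) > 0` and `s2(t̄) < 0`. -/
theorem reduced_system_collision_controllability
    (c α : ℝ) (hc : c ≠ 0) (hα : c^2 / 2 ≤ α)
    (p0 s0 : ℝ) (hs0 : s0 < 0) :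
    |(-(c^2 / 2))| ≤ α ∧
    ∃ τ : ℝ, 0 < τ ∧ ∃ p s : ℝ → ℝ,
      p 0 = p0 ∧ s 0 = s0 ∧
      (∀ t ∈ Ico (0:ℝ) τ,
        HasDerivAt p ((1/2) * ((p t)^2 - c^2) * Real.exp (2 * s t) + c^2 / 2) t ∧
        HasDerivAt s (p t / 2 * (1 - Real.exp (2 * s t))) t) ∧
      (∀ t ∈ Ico (0:ℝ) τ, s t < 0) ∧
      Tendsto s (𝓝[<] τ) (𝓝 0) ∧
      (∀ tb ∈ Ico (0:ℝ) τ, 0 < p tb ∧ s tb < 0 →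
        τ ≤ tb + 2 * Real.exp (-2 * s tb) / p tb) := by
  refine ⟨by rwa [abs_neg, abs_of_nonneg (by positivity)], ?_⟩
  set g : ℝ → ℝ := fun u ↦ c ^ 2 / 4 * tanh u ^ 3 with hg
  have hk : 0 < c ^ 2 / 4 := by positivity
  have hgd : ContDiff ℝ 1 fun u ↦ -g u := (contDiff_const.mul (contDiff_tanh.pow 3)).neg
  have hgb : ∀ u, |-g u| ≤ c ^ 2 / 4 := fun u ↦ by
    rw [abs_neg, hg, abs_mul, abs_of_pos hk, abs_pow]
    exact mul_le_of_le_one_right hk.le (pow_le_one₀ (abs_nonneg _) (abs_tanh_lt_one u).le)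
  have hgm : Monotone g := fun u v huv ↦
    mul_le_mul_of_nonneg_left
      ((Odd.strictMono_pow (by decide)).monotone (strictMono_tanh.monotone huv)) hk.le
  have hgpos : ∀ u, 0 < u → 0 < g u := fun u hu ↦ mul_pos hk (pow_pos (tanh_pos_of_pos hu) 3)
  have h1 : 1 < exp (-s0) := one_lt_exp_iff.mpr (by linarith)
  set x₀ := arcosh (exp (-s0))
  have hx₀ : 0 < x₀ := arcosh_pos h1
  have hcosh : cosh x₀ = exp (-s0) := cosh_arcosh h1.le
  obtain ⟨x, y, hx0, hy0, hx, hy⟩ :=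
    exists_global_solution_second_order hgd hgb x₀ (-(p0 * sinh x₀ / cosh x₀ / 2))
  obtain ⟨τ, hτ, hxτ, hpos, hanti⟩ :=
    exists_first_zero_of_attracting hgm hgpos hx hy (hx0 ▸ hx₀)
  refine ⟨τ, hτ, fun t ↦ -2 * y t * cosh (x t) / sinh (x t), fun t ↦ -log (cosh (x t)),
    ?_, ?_, fun t ht ↦ hasDerivAt_reduced_system (hx t) (hy t) (hpos t ht),
    fun t ht ↦ neg_log_cosh_neg (hpos t ht).ne', ?_, ?_⟩
  · have hS : sinh x₀ ≠ 0 := (sinh_pos_iff.mpr hx₀).ne'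
    have hC : cosh x₀ ≠ 0 := (cosh_pos _).ne'
    simp only [hx0, hy0]
    field_simp
  · simp [hx0, hcosh]
  · have hcont : ContinuousAt (fun t ↦ -log (cosh (x t))) τ :=
      ((hx τ).cosh.log (cosh_pos _).ne').neg.continuousAt
    have h := hcont.tendsto.mono_left (nhdsWithin_le_nhds (s := Iio τ))
    simpa [hxτ] using h
  · rintro t ht ⟨hp, -⟩
    have hS : 0 < sinh (x t) := sinh_pos_iff.mpr (hpos t ht)
    have hC : 1 ≤ cosh (x t) := one_le_cosh _
    have htan := le_tangent_of_antitoneOn_deriv ht.2.le hx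
      (hanti.mono (Icc_subset_Icc_left ht.1))
    have hself : x t ≤ sinh (x t) := self_le_sinh_iff.mpr (hpos t ht).le
    have hexp : exp (-2 * -log (cosh (x t))) = cosh (x t) ^ 2 := by
      rw [neg_mul, exp_neg, exp_two_mul_neg_log_cosh, inv_inv]
    have hynum : 0 < -2 * y t * cosh (x t) := by
      simpa [hS.ne'] using mul_pos hp hS
    have hyneg : 0 < -y t := by
      have := pos_of_mul_pos_left hynum (by linarith)
      linarith
    simp only [hexp]
    rw [hxτ] at htan
    have hdiv : 2 * cosh (x t) ^ 2 / (-2 * y t * cosh (x t) / sinh (x t)) =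
        cosh (x t) * sinh (x t) / (-y t) := by
      have := hyneg.ne'
      field_simp
    rw [hdiv, ← sub_le_iff_le_add', le_div_iff₀ hyneg]
    nlinarith
end

section
/- Let c ∈ ℝ, α > 0, τ < ∞, let a1 : [0,τ] → [-α, α] be measurable, and let (p̃2, s2) solve the reduced system p̃2' = (1/2)(p̃2² - c²)·e^{2·s2} - a1, s2' = (p̃2/2)(1 - e^{2·s2}) on [0, τ) with s2(t) < 0 for all t ∈ [0, τ) and s2(t) → 0 as t → τ⁻ (i.e. a collision occurs at time τ). Then p̃2(t) → +∞ as t → τ⁻. -/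
open Real Set Filter Topology

/-- A function with nonnegative derivative on `[a, b)` is monotone there. -/
theorem monotoneOn_Ico_of_hasDerivAt_nonneg {f f' : ℝ → ℝ} {a b : ℝ}
    (hf : ∀ t ∈ Ico a b, HasDerivAt f (f' t) t) (hf' : ∀ t ∈ Ico a b, 0 ≤ f' t) :
    MonotoneOn f (Ico a b) := by
  refine monotoneOn_of_hasDerivWithinAt_nonneg (convex_Ico a b)
    (fun t ht => (hf t ht).continuousAt.continuousWithinAt)
    (fun t ht => (hf t (interior_subset ht)).hasDerivWithinAt)
    (fun t ht => hf' t (interior_subset ht))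

/-- If `s' = (p / 2) (1 - exp (2 s))` on `[0, τ)` with `s < 0` there and `s → 0` at `τ`,
then `p` is unbounded above on `[0, τ)`. -/
theorem exists_lt_of_collision {τ : ℝ} {p s : ℝ → ℝ} (hτ : 0 < τ)
    (hs : ∀ t ∈ Ico (0:ℝ) τ, HasDerivAt s (p t / 2 * (1 - Real.exp (2 * s t))) t)
    (hneg : ∀ t ∈ Ico (0:ℝ) τ, s t < 0)
    (hcol : Tendsto s (𝓝[<] τ) (𝓝 0)) (M : ℝ) :
    ∃ t ∈ Ico (0:ℝ) τ, M < p t := by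
  by_contra! hM
  have hpos : ∀ t ∈ Ico (0:ℝ) τ, 0 < Real.exp (-2 * s t) - 1 := fun t ht => by
    have := Real.one_lt_exp_iff.2 (show 0 < -2 * s t by linarith [hneg t ht])
    linarith
  have hmono : MonotoneOn (fun t => (Real.exp (-2 * s t) - 1) * Real.exp (M * t))
      (Ico (0:ℝ) τ) := by
    refine monotoneOn_Ico_of_hasDerivAt_nonneg
      (f' := fun t => (M - p t) * ((Real.exp (-2 * s t) - 1) * Real.exp (M * t)))
      (fun t ht => ?_) (fun t ht => ?_)
    · have h := ((((hs t ht).const_mul (-2)).exp.sub_const 1).mul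
        ((hasDerivAt_id t).const_mul M).exp)
      refine h.congr_deriv ?_
      have he : Real.exp (-2 * s t) * Real.exp (2 * s t) = 1 := by
        rw [← Real.exp_add]; simp
      simp only [id]
      linear_combination (p t * Real.exp (M * t)) * he
    · exact mul_nonneg (sub_nonneg.2 (hM t ht)) (mul_pos (hpos t ht) (Real.exp_pos _)).le
  have h0 : (0:ℝ) ∈ Ico 0 τ := ⟨le_rfl, hτ⟩
  have hlim : Tendsto (fun t => (Real.exp (-2 * s t) - 1) * Real.exp (M * t)) (𝓝[<] τ)
      (𝓝 ((Real.exp (-2 * 0) - 1) * Real.exp (M * τ))) := by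
    refine (((hcol.const_mul (-2)).rexp).sub_const 1).mul ?_
    exact (Continuous.tendsto (by fun_prop : Continuous fun t => Real.exp (M * t)) τ).mono_left
      nhdsWithin_le_nhds
  have hle := ge_of_tendsto hlim (by
    filter_upwards [Ico_mem_nhdsLT hτ] with t ht using hmono h0 ht ht.1)
  have := hpos 0 h0
  simp only [mul_zero, Real.exp_zero, sub_self, zero_mul, mul_one] at hle
  linarith

/-- at a collision (`s2(t) → 0` as `t → τ⁻` with `s2 < 0` before `τ`)
of the reduced system driven by any admissible measurable control,
the momentum variable blows up: `p̃2(t) → +∞` as `t → τ⁻`. -/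
theorem reduced_system_p2_blows_up_at_collision
    (c α τ : ℝ) (hα : 0 < α) (hτ : 0 < τ)
    (a1 p s : ℝ → ℝ)
    (ha1 : Measurable a1)
    (hbound : ∀ t ∈ Icc (0:ℝ) τ, a1 t ∈ Icc (-α) α)
    (hsol : ∀ t ∈ Ico (0:ℝ) τ,
      HasDerivAt p ((1/2) * ((p t)^2 - c^2) * Real.exp (2 * s t) - a1 t) t ∧
      HasDerivAt s (p t / 2 * (1 - Real.exp (2 * s t))) t)
    (hneg : ∀ t ∈ Ico (0:ℝ) τ, s t < 0)
    (hcol : Tendsto s (𝓝[<] τ) (𝓝 0)) :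
    Tendsto p (𝓝[<] τ) atTop := by
  set K : ℝ := c ^ 2 / 2 + α with hK
  have hK0 : 0 ≤ K := by positivity
  have hmono : MonotoneOn (fun t => p t + K * t) (Ico (0:ℝ) τ) := by
    refine monotoneOn_Ico_of_hasDerivAt_nonneg
      (fun t ht => (hsol t ht).1.add ((hasDerivAt_id t).const_mul K)) (fun t ht => ?_)
    have ha := (hbound t ⟨ht.1, ht.2.le⟩).2
    have he : Real.exp (2 * s t) ≤ 1 := Real.exp_le_one_iff.2 (by linarith [hneg t ht])
    have hp := mul_nonneg (sq_nonneg (p t)) (Real.exp_pos (2 * s t)).le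
    have hc := mul_le_mul_of_nonneg_left he (sq_nonneg c)
    linarith
  refine tendsto_atTop.2 fun B => ?_
  obtain ⟨t, ht, hBt⟩ :=
    exists_lt_of_collision hτ (fun t ht => (hsol t ht).2) hneg hcol (B + K * τ)
  filter_upwards [Ico_mem_nhdsLT ht.2] with r hr
  have h : p t + K * t ≤ p r + K * r := hmono ht ⟨ht.1.trans hr.1, hr.2⟩ hr.1
  have h1 := mul_le_mul_of_nonneg_left hr.2.le hK0
  have h2 := mul_nonneg hK0 ht.1
  linarith
end
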